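/- Let A be a measurable 3-sum-free subset of [0,1] with μ(A) = 77/177. Then μ(A Δ 𝒜₀) = 0, where A Δ 𝒜₀ denotes the symmetric difference of A and 𝒜₀. -/

import Mathlib

open MeasureTheory Set
open scoped Pointwise Topology


lemma cell_upper (p : ℕ) [Fact p.Prime] (w ℓ : ℝ) (hw : 0 < w) (hpw : p * w = ℓ) (X : Set ℝ)
    (hX : X ⊆ Icc 0 ℓ) (Z : Finset (ZMod p))
    (hZ : ∀ x ∈ X, ((⌊x / w⌋ : ℤ) : ZMod p) ∈ Z) : volume.real X ≤ Z.card * w := by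
  have hsub : X ⊆ (⋃ i ∈ Z, Ico ((i.val : ℝ) * w) ((i.val + 1 : ℝ) * w)) ∪ {ℓ} := by
    intro x hx
    obtain ⟨h0, h1⟩ := hX hx
    rcases h1.eq_or_lt with h1 | h1
    · right; exact h1
    left
    simp only [mem_iUnion]
    refine ⟨_, hZ x hx, ?_⟩
    have hf0 : 0 ≤ ⌊x / w⌋ := Int.floor_nonneg.2 (by positivity)
    have hf1 : ⌊x / w⌋ < p := by
      rw [Int.floor_lt]
      rw [div_lt_iff₀ hw]; push_cast; linarith
    have hv : (((⌊x / w⌋ : ZMod p).val : ℤ)) = ⌊x / w⌋ := by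
      rw [ZMod.val_intCast]; exact Int.emod_eq_of_lt hf0 hf1
    have hv' : (((⌊x / w⌋ : ZMod p).val : ℝ)) = ⌊x / w⌋ := by exact_mod_cast hv
    rw [hv']
    constructor
    · have := Int.floor_le (x / w)
      rwa [le_div_iff₀ hw] at this
    · have := Int.lt_floor_add_one (x / w)
      rwa [div_lt_iff₀ hw] at this
  have hfin : volume ((⋃ i ∈ Z, Ico ((i.val : ℝ) * w) ((i.val + 1 : ℝ) * w)) ∪ {ℓ}) ≠ ⊤ := by
    refine measure_union_ne_top ?_ (by simp)
    refine ((measure_biUnion_finset_le Z _).trans_lt ?_).ne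
    exact ENNReal.sum_lt_top.2 (fun i _ => by simp [Real.volume_Ico])
  calc volume.real X ≤ _ := measureReal_mono hsub hfin
    _ ≤ volume.real (⋃ i ∈ Z, Ico ((i.val : ℝ) * w) ((i.val + 1 : ℝ) * w)) + volume.real {ℓ} :=
        measureReal_union_le _ _
    _ ≤ (∑ i ∈ Z, volume.real (Ico ((i.val : ℝ) * w) ((i.val + 1 : ℝ) * w))) + 0 := by
        gcongr
        · exact measureReal_biUnion_finset_le _ _
        · simp [Measure.real]
    _ = Z.card * w := by
        have : ∀ i ∈ Z, volume.real (Ico ((i.val : ℝ) * w) ((i.val + 1 : ℝ) * w)) = w := by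
          intro i _
          rw [Real.volume_real_Ico_of_le (by nlinarith)]; ring
        rw [Finset.sum_congr rfl this]; simp

lemma cell_lower (p : ℕ) [Fact p.Prime] (w ℓ : ℝ) (hw : 0 < w) (hpw : p * w = ℓ) (V : Set ℝ)
    (Z : Finset (ZMod p))
    (hZ : ∀ k ∈ Z, ∃ v ∈ V, (k.val : ℝ) * w ≤ v ∧ v ≤ (k.val + 2 : ℝ) * w) :
    Z.card * w ≤ (volume.restrict (Icc 0 ℓ)).real (Metric.cthickening (2 * w) V) := by
  have hd : (Z : Set (ZMod p)).PairwiseDisjoint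
      (fun i => Ico ((i.val : ℝ) * w) ((i.val + 1 : ℝ) * w)) := by
    intro i _ j _ hij
    rw [Function.onFun, Set.disjoint_left]
    rintro x ⟨h1, h2⟩ ⟨h3, h4⟩
    apply hij
    apply ZMod.val_injective p
    have a1 : (i.val : ℝ) < j.val + 1 := lt_of_mul_lt_mul_right (h1.trans_lt h4) hw.le
    have a2 : (j.val : ℝ) < i.val + 1 := lt_of_mul_lt_mul_right (h3.trans_lt h2) hw.le
    have a1' : i.val < j.val + 1 := by exact_mod_cast a1
    have a2' : j.val < i.val + 1 := by exact_mod_cast a2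
    omega
  rw [measureReal_restrict_apply Metric.isClosed_cthickening.measurableSet]
  have hsub : (⋃ i ∈ Z, Ico ((i.val : ℝ) * w) ((i.val + 1 : ℝ) * w)) ⊆
      Metric.cthickening (2 * w) V ∩ Icc 0 ℓ := by
    intro u hu
    simp only [mem_iUnion] at hu
    obtain ⟨k, hk, h1, h2⟩ := hu
    obtain ⟨v, hv, h3, h4⟩ := hZ k hk
    refine ⟨Metric.mem_cthickening_of_dist_le u v _ _ hv ?_, ?_, ?_⟩
    · rw [Real.dist_eq, abs_le]; constructor <;> nlinarith
    · exact le_trans (by positivity) h1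
    · have : (k.val : ℝ) + 1 ≤ p := by exact_mod_cast ZMod.val_lt k
      nlinarith
  calc (Z.card : ℝ) * w = ∑ i ∈ Z, volume.real (Ico ((i.val : ℝ) * w) ((i.val + 1 : ℝ) * w)) := by
        have : ∀ i ∈ Z, volume.real (Ico ((i.val : ℝ) * w) ((i.val + 1 : ℝ) * w)) = w := by
          intro i _
          rw [Real.volume_real_Ico_of_le (by nlinarith)]; ring
        rw [Finset.sum_congr rfl this]; simp
    _ = volume.real (⋃ i ∈ Z, Ico ((i.val : ℝ) * w) ((i.val + 1 : ℝ) * w)) := by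
        rw [measureReal_biUnion_finset hd (fun _ _ => measurableSet_Ico)
          (fun _ _ => by simp [Real.volume_Ico])]
    _ ≤ _ := measureReal_mono hsub
        ((measure_mono inter_subset_right).trans_lt (by simp [Real.volume_Icc])).ne

lemma raikov_p (p : ℕ) (hp : p.Prime) (w ℓ : ℝ) (hw : 0 < w) (hpw : p * w = ℓ) (X Y : Set ℝ)
    (hX : X ⊆ Icc 0 ℓ) (hY : Y ⊆ Icc 0 ℓ) (hXn : X.Nonempty) (hYn : Y.Nonempty) :
    min ℓ (volume.real X + volume.real Y - w) ≤ (volume.restrict (Icc 0 ℓ)).real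
      (Metric.cthickening (2 * w) (X + Y + ({0, -ℓ, -(2 * ℓ)} : Set ℝ))) := by
  classical
  have : Fact p.Prime := ⟨hp⟩
  set XF : Finset (ZMod p) := Finset.univ.filter (fun i => ∃ x ∈ X, ((⌊x / w⌋ : ℤ) : ZMod p) = i)
  set YF : Finset (ZMod p) := Finset.univ.filter (fun i => ∃ x ∈ Y, ((⌊x / w⌋ : ℤ) : ZMod p) = i)
  have h1 := cell_upper p w ℓ hw hpw X hX XF (fun x hx => by simp only [XF, Finset.mem_filter, Finset.mem_univ, true_and]; exact ⟨x, hx, rfl⟩)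
  have h2 := cell_upper p w ℓ hw hpw Y hY YF (fun x hx => by simp only [YF, Finset.mem_filter, Finset.mem_univ, true_and]; exact ⟨x, hx, rfl⟩)
  have hXF : XF.Nonempty := by
    obtain ⟨x, hx⟩ := hXn
    exact ⟨_, by simp only [XF, Finset.mem_filter, Finset.mem_univ, true_and]; exact ⟨x, hx, rfl⟩⟩
  have hYF : YF.Nonempty := by
    obtain ⟨x, hx⟩ := hYn
    exact ⟨_, by simp only [YF, Finset.mem_filter, Finset.mem_univ, true_and]; exact ⟨x, hx, rfl⟩⟩
  have hcd := ZMod.cauchy_davenport hp hXF hYF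
  have h3 := cell_lower p w ℓ hw hpw (X + Y + ({0, -ℓ, -(2 * ℓ)} : Set ℝ)) (XF + YF) (by
    intro k hk
    rw [Finset.mem_add] at hk
    obtain ⟨i, hi, j, hj, rfl⟩ := hk
    simp only [XF, YF, Finset.mem_filter, Finset.mem_univ, true_and] at hi hj
    obtain ⟨x, hx, rfl⟩ := hi
    obtain ⟨y, hy, rfl⟩ := hj
    have hfl : ∀ x ∈ Icc 0 ℓ, 0 ≤ ⌊x / w⌋ ∧ ⌊x / w⌋ ≤ p ∧ (⌊x / w⌋ : ℝ) * w ≤ x ∧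
        x ≤ (⌊x / w⌋ + 1 : ℝ) * w := by
      intro x hx
      refine ⟨Int.floor_nonneg.2 (div_nonneg hx.1 hw.le), ?_, ?_, ?_⟩
      · have : (⌊x / w⌋ : ℝ) ≤ p := (Int.floor_le _).trans (by rw [div_le_iff₀ hw, hpw]; exact hx.2)
        exact_mod_cast this
      · have := Int.floor_le (x / w)
        rwa [le_div_iff₀ hw] at this
      · have := Int.lt_floor_add_one (x / w)
        rw [div_lt_iff₀ hw] at this
        exact this.le
    obtain ⟨a1, a2, a3, a4⟩ := hfl x (hX hx)
    obtain ⟨b1, b2, b3, b4⟩ := hfl y (hY hy)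
    set s := ⌊x / w⌋ with hs
    set t := ⌊y / w⌋ with ht
    have hp0 : (0 : ℤ) < p := by exact_mod_cast hp.pos
    have hval : ((((s : ZMod p) + (t : ZMod p)).val : ℕ) : ℤ) = (s + t) % p := by
      rw [← Int.cast_add, ZMod.val_intCast]
    have hq : ∃ n : ℤ, (n = 0 ∨ n = 1 ∨ n = 2) ∧ (s + t) % p = s + t - n * p := by
      refine ⟨(s + t) / p, ?_, ?_⟩
      · have q0 : 0 ≤ (s + t) / p := Int.ediv_nonneg (by omega) hp0.le
        have q1 : (s + t) / p < 3 := by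
          rw [Int.ediv_lt_iff_lt_mul hp0]; omega
        omega
      · have := Int.emod_add_mul_ediv (s + t) p
        linarith
    obtain ⟨n, hn, hn2⟩ := hq
    have hval' : ((((s : ZMod p) + (t : ZMod p)).val : ℕ) : ℝ) = s + t - n * p := by
      have : ((((s : ZMod p) + (t : ZMod p)).val : ℕ) : ℤ) = s + t - n * p := by rw [hval, hn2]
      exact_mod_cast this
    refine ⟨x + y + (-(n * ℓ)), add_mem_add (add_mem_add hx hy) ?_, ?_, ?_⟩
    · rcases hn with rfl | rfl | rfl <;> simp
    · rw [hval', ← hpw]; nlinarith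
    · rw [hval', ← hpw]; nlinarith)
  refine le_trans ?_ h3
  rcases min_le_iff.1 hcd with h | h
  · refine (min_le_left _ _).trans ?_
    rw [← hpw]
    have : (p : ℝ) ≤ (XF + YF).card := by exact_mod_cast h
    exact mul_le_mul_of_nonneg_right this hw.le
  · refine (min_le_right _ _).trans ?_
    have h' : XF.card + YF.card ≤ (XF + YF).card + 1 := by omega
    have : (XF.card : ℝ) + YF.card ≤ (XF + YF).card + 1 := by exact_mod_cast h'
    nlinarith

lemma raikov (ℓ : ℝ) (hℓ : 0 < ℓ) (X Y : Set ℝ) (hXc : IsCompact X) (hYc : IsCompact Y)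
    (hX : X ⊆ Icc 0 ℓ) (hY : Y ⊆ Icc 0 ℓ) (hXn : X.Nonempty) (hYn : Y.Nonempty) :
    min ℓ (volume.real X + volume.real Y) ≤
      volume.real ((X + Y + ({0, -ℓ, -(2 * ℓ)} : Set ℝ)) ∩ Icc 0 ℓ) := by
  set V := X + Y + ({0, -ℓ, -(2 * ℓ)} : Set ℝ) with hV
  have hVc : IsCompact V := (hXc.add hYc).add (by apply Set.Finite.isCompact; simp)
  set ν := volume.restrict (Icc 0 ℓ) with hν
  rw [← measureReal_restrict_apply hVc.isClosed.measurableSet]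
  have ht := tendsto_measure_cthickening_of_isClosed (μ := ν) (s := V)
    ⟨1, one_pos, measure_ne_top _ _⟩ hVc.isClosed
  have ht' : Filter.Tendsto (fun r => ν.real (Metric.cthickening r V)) (𝓝 0) (𝓝 (ν.real V)) :=
    (ENNReal.tendsto_toReal (measure_ne_top _ _)).comp ht
  apply le_of_forall_pos_le_add
  intro ε hε
  have hev : ∀ᶠ r in 𝓝 (0 : ℝ), ν.real (Metric.cthickening r V) < ν.real V + ε / 2 :=
    ht'.eventually (gt_mem_nhds (by linarith))
  rw [Metric.eventually_nhds_iff] at hev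
  obtain ⟨δ, hδ, hev⟩ := hev
  obtain ⟨N, hN⟩ := exists_nat_gt (ℓ / (min (δ / 2) (ε / 2)))
  obtain ⟨p, hpN, hp⟩ := Nat.exists_infinite_primes N
  have hp0 : (0 : ℝ) < p := by exact_mod_cast hp.pos
  have hmin : 0 < min (δ / 2) (ε / 2) := by positivity
  have hw : ℓ / p < min (δ / 2) (ε / 2) := by
    rw [div_lt_iff₀ hp0]
    rw [div_lt_iff₀ hmin] at hN
    have : (N : ℝ) ≤ p := by exact_mod_cast hpN
    nlinarith
  have hw0 : 0 < ℓ / p := by positivity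
  have key := raikov_p p hp (ℓ / p) ℓ hw0 (by field_simp) X Y hX hY hXn hYn
  have h5 := hev (y := 2 * (ℓ / p)) (by
    rw [Real.dist_eq, sub_zero, abs_of_pos (by positivity)]
    have := hw.trans_le (min_le_left _ _)
    linarith)
  have h6 := hw.trans_le (min_le_right _ _)
  have h7 : min ℓ (volume.real X + volume.real Y) ≤
      min ℓ (volume.real X + volume.real Y - ℓ / p) + ℓ / p := by
    rw [← min_add_add_right]
    apply min_le_min <;> linarith
  rw [← hV, ← hν] at key
  linarith

/-- measure of the part of `S` in `[s,t]` -/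
noncomputable def mm (S : Set ℝ) (s t : ℝ) : ℝ := volume.real (S ∩ Icc s t)

lemma mm_ne_top (S : Set ℝ) (s t : ℝ) : volume (S ∩ Icc s t) ≠ ⊤ :=
  ((measure_mono inter_subset_right).trans_lt (by simp [Real.volume_Icc])).ne

lemma mm_nonneg (S : Set ℝ) (s t : ℝ) : 0 ≤ mm S s t := measureReal_nonneg

lemma mm_mono (S : Set ℝ) {s t s' t' : ℝ} (h1 : s' ≤ s) (h2 : t ≤ t') : mm S s t ≤ mm S s' t' :=
  measureReal_mono (inter_subset_inter_right _ (Icc_subset_Icc h1 h2)) (mm_ne_top _ _ _)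

lemma mm_le (S : Set ℝ) {s t : ℝ} (h : s ≤ t) : mm S s t ≤ t - s := by
  rw [← Real.volume_real_Icc_of_le h]
  exact measureReal_mono inter_subset_right (by simp [Real.volume_Icc])

lemma mm_empty (S : Set ℝ) {s t : ℝ} (h : t < s) : mm S s t = 0 := by
  simp [mm, Icc_eq_empty (not_le.2 h)]

lemma mm_sub (S : Set ℝ) (s u t : ℝ) : mm S s t ≤ mm S s u + mm S u t := by
  refine le_trans (measureReal_mono (s₂ := (S ∩ Icc s u) ∪ (S ∩ Icc u t)) ?_ ?_)
    (measureReal_union_le _ _)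
  · rintro x ⟨h, h1, h2⟩
    rcases le_total x u with h3 | h3
    · exact Or.inl ⟨h, h1, h3⟩
    · exact Or.inr ⟨h, h3, h2⟩
  · exact measure_union_ne_top (mm_ne_top _ _ _) (mm_ne_top _ _ _)

lemma mm_super (S : Set ℝ) (hS : MeasurableSet S) (s u t : ℝ) (h1 : s ≤ u) (h2 : u ≤ t) :
    mm S s u + mm S u t ≤ mm S s t := by
  have e := measureReal_union_add_inter (μ := volume) (s := S ∩ Icc s u) (t := S ∩ Icc u t)
    (hS.inter measurableSet_Icc) (mm_ne_top _ _ _) (mm_ne_top _ _ _)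
  have e2 : volume.real ((S ∩ Icc s u) ∩ (S ∩ Icc u t)) = 0 := by
    have : (S ∩ Icc s u) ∩ (S ∩ Icc u t) ⊆ {u} := by
      rintro x ⟨⟨_, _, h1⟩, _, h2, _⟩
      exact le_antisymm h1 h2
    refine le_antisymm ((measureReal_mono this (by simp)).trans (by simp [Measure.real])) measureReal_nonneg
  have e3 : volume.real ((S ∩ Icc s u) ∪ (S ∩ Icc u t)) ≤ mm S s t := by
    refine measureReal_mono ?_ (mm_ne_top _ _ _)
    rintro x (⟨h, h3, h4⟩ | ⟨h, h3, h4⟩)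
    · exact ⟨h, h3, h4.trans h2⟩
    · exact ⟨h, h1.trans h3, h4⟩
  unfold mm at *
  linarith

lemma mm_add (S : Set ℝ) (hS : MeasurableSet S) (s u t : ℝ) (h1 : s ≤ u) (h2 : u ≤ t) :
    mm S s t = mm S s u + mm S u t :=
  le_antisymm (mm_sub _ _ _ _) (mm_super _ hS _ _ _ h1 h2)

lemma mm_full (S : Set ℝ) (s t : ℝ) (h : S ⊆ Icc s t) : mm S s t = volume.real S := by
  rw [mm, inter_eq_left.2 h]

lemma real_vadd (x : ℝ) (S : Set ℝ) : volume.real ((fun u => u + x) ⁻¹' S) = volume.real S := by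
  rw [Measure.real, measure_preimage_add_right, Measure.real]

lemma sumset_G0 (ℓ : ℝ) (hℓ : 0 < ℓ) (X Y : Set ℝ) (hXc : IsCompact X) (hYc : IsCompact Y)
    (hX : X ⊆ Icc 0 ℓ) (hY : Y ⊆ Icc 0 ℓ) (hXn : X.Nonempty) (h0 : 0 ∈ Y) (h1 : ℓ ∈ Y) :
    min ℓ (volume.real X + volume.real Y) + volume.real X ≤ volume.real (X + Y) := by
  have hR := raikov ℓ hℓ X Y hXc hYc hX hY hXn ⟨0, h0⟩
  have hSc := hXc.add hYc
  set S := X + Y with hS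
  have hSm := hSc.isClosed.measurableSet
  have hSsub : S ⊆ Icc 0 (2 * ℓ) := by
    rintro _ ⟨x, hx, y, hy, rfl⟩
    have := hX hx; have := hY hy
    simp only [mem_Icc] at *
    constructor <;> linarith
  set S1 := S ∩ Icc 0 ℓ with hS1
  set S2 := (fun u => u + ℓ) ⁻¹' (S ∩ Icc ℓ (2 * ℓ)) with hS2
  have hS2m : MeasurableSet S2 := (measurable_add_const ℓ) (hSm.inter measurableSet_Icc)
  have hS2v : volume.real S2 = mm S ℓ (2 * ℓ) := real_vadd _ _
  have hS2t : volume S2 ≠ ⊤ := by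
    rw [hS2, measure_preimage_add_right]; exact mm_ne_top _ _ _
  have hS1t : volume S1 ≠ ⊤ := mm_ne_top _ _ _
  have hsum : mm S 0 (2 * ℓ) = mm S 0 ℓ + mm S ℓ (2 * ℓ) :=
    mm_add S hSm _ _ _ hℓ.le (by linarith)
  rw [mm_full S _ _ hSsub] at hsum
  have e := measureReal_union_add_inter (μ := volume) (s := S1) (t := S2) hS2m hS1t hS2t
  have hi : volume.real X ≤ volume.real (S1 ∩ S2) := by
    refine measureReal_mono ?_ ((measure_mono inter_subset_left).trans_lt hS1t.lt_top).ne
    intro x hx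
    have hxx := hX hx
    refine ⟨⟨⟨x, hx, 0, h0, by simp⟩, hxx⟩, ⟨⟨x, hx, ℓ, h1, rfl⟩, ?_, ?_⟩⟩
    · linarith [hxx.1]
    · linarith [hxx.2]
  have hu : volume.real ((S + ({0, -ℓ, -(2 * ℓ)} : Set ℝ)) ∩ Icc 0 ℓ) ≤ volume.real (S1 ∪ S2) := by
    have hsub : (S + ({0, -ℓ, -(2 * ℓ)} : Set ℝ)) ∩ Icc 0 ℓ ⊆ (S1 ∪ S2) ∪ {0} := by
      rintro _ ⟨⟨s, hs, n, hn, rfl⟩, hv0, hv1⟩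
      simp only [mem_insert_iff, mem_singleton_iff] at hn
      have hss := hSsub hs
      simp only [mem_Icc] at hss
      rcases hn with rfl | rfl | rfl
      · left; left
        simp only [add_zero] at *
        exact ⟨hs, hv0, hv1⟩
      · left; right
        simp only at hv0 hv1
        refine ⟨by simpa using hs, ?_, ?_⟩ <;> simp <;> linarith
      · right
        simp only at hv0 hv1 ⊢
        rw [mem_singleton_iff]; linarith
    refine (measureReal_mono hsub (measure_union_ne_top (measure_union_ne_top hS1t hS2t) (by simp))).trans ?_
    refine (measureReal_union_le _ _).trans ?_
    simp [Measure.real]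
  have : volume.real S1 = mm S 0 ℓ := rfl
  linarith

lemma sumset_G (x0 y0 ℓ : ℝ) (hℓ : 0 ≤ ℓ) (X Y : Set ℝ) (hXc : IsCompact X) (hYc : IsCompact Y)
    (hX : X ⊆ Icc x0 (x0 + ℓ)) (hY : Y ⊆ Icc y0 (y0 + ℓ)) (hXn : X.Nonempty)
    (h0 : y0 ∈ Y) (h1 : y0 + ℓ ∈ Y) :
    min ℓ (volume.real X + volume.real Y) + volume.real X ≤ volume.real (X + Y) := by
  rcases hℓ.eq_or_lt with rfl | hℓ
  · have : volume.real X ≤ 0 := by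
      have := mm_le X (s := x0) (t := x0 + 0) (by simp)
      rw [mm_full X _ _ hX] at this
      linarith
    have := min_le_left (0 : ℝ) (volume.real X + volume.real Y)
    have : 0 ≤ volume.real (X + Y) := measureReal_nonneg
    linarith
  have hXc' : IsCompact ((fun u => u + x0) ⁻¹' X) :=
    (Homeomorph.addRight x0).isClosedEmbedding.isCompact_preimage hXc
  have hYc' : IsCompact ((fun u => u + y0) ⁻¹' Y) :=
    (Homeomorph.addRight y0).isClosedEmbedding.isCompact_preimage hYc
  have := sumset_G0 ℓ hℓ _ _ hXc' hYc'
    (fun u hu => by have := hX hu; simp only [mem_Icc] at *; constructor <;> linarith)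
    (fun u hu => by have := hY hu; simp only [mem_Icc] at *; constructor <;> linarith)
    (by obtain ⟨x, hx⟩ := hXn; exact ⟨x - x0, by simpa using hx⟩)
    (by simpa using h0) (by simpa [add_comm] using h1)
  rw [real_vadd, real_vadd] at this
  refine this.trans ?_
  rw [← real_vadd (x0 + y0) (X + Y)]
  refine measureReal_mono ?_ ?_
  · rintro _ ⟨a, ha, b, hb, rfl⟩
    exact ⟨a + x0, ha, b + y0, hb, by simp only; ring⟩
  · rw [measure_preimage_add_right]
    exact (hXc.add hYc).measure_lt_top.ne

/-- Packing: `P + Q` and `3 W` are disjoint in `[lo,hi]`. -/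
lemma packing (S P Q : Set ℝ) (lo hi s t : ℝ) (hlh : lo ≤ hi)
    (hS : IsCompact S) (hP : IsCompact P) (hQ : IsCompact Q)
    (hPS : P ⊆ S) (hQS : Q ⊆ S)
    (hsf : ∀ x ∈ S, ∀ y ∈ S, ∀ z ∈ S, x + y ≠ 3 * z)
    (hPQ : P + Q ⊆ Icc lo hi) (hW : ∀ w ∈ S, s ≤ w → w ≤ t → lo ≤ 3 * w ∧ 3 * w ≤ hi) :
    3 * mm S s t + volume.real (P + Q) ≤ hi - lo := by
  set W := S ∩ Icc s t with hWd
  have h3 : volume.real ((3 : ℝ) • W) = 3 * mm S s t := by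
    rw [Measure.real, Measure.addHaar_smul]
    simp [mm, Measure.real, hWd]
  have hWc : IsCompact W := hS.inter_right isClosed_Icc
  have hd : Disjoint ((3 : ℝ) • W) (P + Q) := by
    rw [Set.disjoint_left]
    rintro _ ⟨w, hw, rfl⟩ ⟨x, hx, y, hy, hxy⟩
    exact hsf x (hPS hx) y (hQS hy) w hw.1 (by simpa using hxy)
  have hm : MeasurableSet (P + Q) := (hP.add hQ).isClosed.measurableSet
  rw [← h3, ← measureReal_union hd hm ((hWc.smul (3:ℝ)).measure_lt_top.ne) (hP.add hQ).measure_lt_top.ne,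
    ← Real.volume_real_Icc_of_le hlh]
  refine measureReal_mono (union_subset ?_ hPQ) (by simp [Real.volume_Icc])
  rintro _ ⟨w, hw, rfl⟩
  simpa using hW w hw.1 hw.2.1 hw.2.2

/-- compact set without solutions to `x + y = 3 z` -/
def SF (S : Set ℝ) : Prop := IsCompact S ∧ ∀ x ∈ S, ∀ y ∈ S, ∀ z ∈ S, x + y ≠ 3 * z

lemma SF.sub {S : Set ℝ} (h : SF S) (s t : ℝ) : SF (S ∩ Icc s t) :=
  ⟨h.1.inter_right isClosed_Icc, fun x hx y hy z hz => h.2 x hx.1 y hy.1 z hz.1⟩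

lemma SF.meas {S : Set ℝ} (h : SF S) : MeasurableSet S := h.1.isClosed.measurableSet

lemma tower1 (S : Set ℝ) (hS : SF S) (m z : ℝ) (hm0 : 0 ≤ m) (hm : IsLeast S m)
    (hz : IsGreatest S z) :
    3 * mm S 0 (2 * z / 3) + min (z - m) (2 * volume.real S) + volume.real S ≤ 2 * z - 2 * m := by
  have hmz : m ≤ z := hm.2 hz.1
  have hsub : S ⊆ Icc m (m + (z - m)) := fun x hx => ⟨hm.2 hx, by linarith [hz.2 hx]⟩
  have hG := sumset_G m m (z - m) (by linarith) S S hS.1 hS.1 hsub hsub ⟨z, hz.1⟩ hm.1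
    (by simpa using hz.1)
  have hp := packing S S S (2 * m) (2 * z) 0 (2 * z / 3) (by linarith) hS.1 hS.1 hS.1 subset_rfl
    subset_rfl hS.2 (by
      rintro _ ⟨x, hx, y, hy, rfl⟩
      have := hm.2 hx; have := hm.2 hy; have := hz.2 hx; have := hz.2 hy
      simp only [mem_Icc]; constructor <;> linarith) (by
      intro w hw h1 h2
      have := hm.2 hw
      constructor <;> linarith)
  rw [two_mul (volume.real S)]
  linarith

lemma top_eq (S : Set ℝ) (z g0 : ℝ) (hg : IsLeast (S ∩ Icc (2 * z / 3) z) g0) :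
    S ∩ Icc (2 * z / 3) z = S ∩ Icc g0 z := by
  ext x
  constructor
  · intro h; exact ⟨h.1, hg.2 h, h.2.2⟩
  · intro h; exact ⟨h.1, hg.1.2.1.trans h.2.1, h.2.2⟩

lemma tower2 (S : Set ℝ) (hS : SF S) (z g0 : ℝ)
    (hz : IsGreatest S z) (hg : IsLeast (S ∩ Icc (2 * z / 3) z) g0)
    (h2 : z - g0 ≤ 2 * mm S (2 * z / 3) z) :
    3 * mm S (2 * g0 / 3) (2 * z / 3) ≤ z - g0 - mm S (2 * z / 3) z := by
  have hgz : g0 ≤ z := hg.1.2.2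
  set G := S ∩ Icc (2 * z / 3) z with hGd
  have hGc : IsCompact G := hS.1.inter_right isClosed_Icc
  have hsub : G ⊆ Icc g0 (g0 + (z - g0)) := fun x hx => ⟨hg.2 hx, by linarith [hz.2 hx.1]⟩
  have hzG : z ∈ G := ⟨hz.1, by linarith [hg.1.2.1], le_rfl⟩
  have hG := sumset_G g0 g0 (z - g0) (by linarith) G G hGc hGc hsub hsub ⟨z, hzG⟩ hg.1
    (by simpa using hzG)
  have hp := packing S G G (2 * g0) (2 * z) (2 * g0 / 3) (2 * z / 3) (by linarith) hS.1 hGc hGc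
    inter_subset_left inter_subset_left hS.2 (by
      rintro _ ⟨x, hx, y, hy, rfl⟩
      have := hg.2 hx; have := hg.2 hy; have := hz.2 hx.1; have := hz.2 hy.1
      simp only [mem_Icc]; constructor <;> linarith) (by
      intro w hw h1 h2
      constructor <;> linarith)
  have e : volume.real G = mm S (2 * z / 3) z := rfl
  rw [e, min_eq_left (by linarith)] at hG
  linarith

lemma tower3 (S : Set ℝ) (hS : SF S) (m z g0 r : ℝ) (hm0 : 0 ≤ m) (hm : IsLeast S m)
    (hz : IsGreatest S z) (hg : IsLeast (S ∩ Icc (2 * z / 3) z) g0)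
    (hr : r ≤ z / 2) (hne : (S ∩ Icc 0 r).Nonempty)
    (hd : z - g0 - mm S (2 * z / 3) z ≤ mm S 0 r) :
    3 * mm S ((g0 + m) / 3) r ≤ z - g0 - mm S (2 * z / 3) z
      + max 0 (r - m - mm S 0 r - mm S (2 * z / 3) z) := by
  have hgz : g0 ≤ z := hg.1.2.2
  set G := S ∩ Icc (2 * z / 3) z with hGd
  have hGc : IsCompact G := hS.1.inter_right isClosed_Icc
  have hzG : z ∈ G := ⟨hz.1, by linarith [hg.1.2.1], le_rfl⟩
  set D := S ∩ Icc 0 r with hDd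
  have hDc : IsCompact D := hS.1.inter_right isClosed_Icc
  obtain ⟨y, hy⟩ := hDc.exists_isGreatest hne
  have hmr : m ≤ r := by
    obtain ⟨x, hx⟩ := hne
    exact (hm.2 hx.1).trans hx.2.2
  have hmD : m ∈ D := ⟨hm.1, hm0, hmr⟩
  have hmy : m ≤ y := hy.2 hmD
  have hyr : y ≤ r := hy.1.2.2
  have hDsub : D ⊆ Icc m (m + (y - m)) := fun x hx => ⟨hm.2 hx.1, by linarith [hy.2 hx]⟩
  have hyD : m + (y - m) ∈ D := by simpa using hy.1
  have eD : volume.real D = mm S 0 r := rfl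
  have eG : volume.real G = mm S (2 * z / 3) z := rfl
  have eG2 : mm S (2 * z / 3) z = mm S g0 z := by
    simp only [mm]; rw [← top_eq S z g0 hg]
  have hWy : ∀ w ∈ S, 0 ≤ w → w ≤ r → 3 * w ≤ z + y := by
    intro w hw h0 h1
    have := hy.2 ⟨hw, h0, h1⟩
    linarith
  have hmS := fun {w} (hw : w ∈ S) => hm.2 hw
  rcases le_total (y - m) (z - g0) with hℓ | hℓ
  · -- short D
    set q := z - (y - m) with hq
    have hgq : g0 ≤ q := by linarith
    have hqz : q ≤ z := by linarith
    have hsplit := mm_add S hS.meas g0 q z hgq hqz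
    have hc'' : mm S g0 q ≤ q - g0 := mm_le S hgq
    set C := S ∩ Icc q z with hC
    have hCc : IsCompact C := hS.1.inter_right isClosed_Icc
    have eC : volume.real C = mm S q z := rfl
    have hG := sumset_G q m (y - m) (by linarith) C D hCc hDc
      (fun x hx => ⟨hx.2.1, by linarith [hx.2.2]⟩) hDsub ⟨z, hz.1, hqz, le_rfl⟩ hmD hyD
    rw [eC, eD, min_eq_left (by linarith)] at hG
    have hp2 := packing S C D (q + m) (z + y) ((q + m) / 3) r (by linarith) hS.1 hCc hDc
      inter_subset_left inter_subset_left hS.2 (by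
        rintro _ ⟨x, hx, y', hy', rfl⟩
        have := hx.2.1; have := hx.2.2; have := hy.2 hy'; have := hm.2 hy'.1
        simp only [mem_Icc]; constructor <;> linarith) (by
        intro w hw h1 h2
        have := hWy w hw (hm0.trans (hmS hw)) h2
        constructor <;> linarith)
    set C2 := S ∩ Icc g0 q with hC2
    have hC2c : IsCompact C2 := hS.1.inter_right isClosed_Icc
    have hp1 := packing S C2 {m} (g0 + m) (q + m) ((g0 + m) / 3) ((q + m) / 3) (by linarith) hS.1
      hC2c isCompact_singleton
      inter_subset_left (by simpa using hm.1) hS.2 (by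
        rintro _ ⟨x, hx, y', rfl, rfl⟩
        have := hx.2.1; have := hx.2.2
        simp only [mem_Icc]; constructor <;> linarith) (by
        intro w hw h1 h2
        constructor <;> linarith)
    have e2 : volume.real (C2 + {m}) = mm S g0 q := by
      have hpre : (fun u => u + m) ⁻¹' (C2 + {m}) = C2 := by
        ext x
        constructor
        · rintro ⟨a, ha, b, rfl, h⟩
          have hax : a = x := by simpa using h
          exact hax ▸ ha
        · intro hx; exact ⟨x, hx, m, rfl, rfl⟩
      rw [← real_vadd m, hpre]; rfl
    have hs := mm_sub S ((g0 + m) / 3) ((q + m) / 3) r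
    have := le_max_left 0 (r - m - mm S 0 r - mm S (2 * z / 3) z)
    linarith
  · have hG := sumset_G (z - (y - m)) m (y - m) (by linarith) G D hGc hDc
      (fun x hx => ⟨by linarith [hg.2 hx], by linarith [hx.2.2]⟩) hDsub ⟨z, hzG⟩ hmD hyD
    rw [eG, eD] at hG
    have hp2 := packing S G D (g0 + m) (z + y) ((g0 + m) / 3) r (by linarith) hS.1 hGc hDc
      inter_subset_left inter_subset_left hS.2 (by
        rintro _ ⟨x, hx, y', hy', rfl⟩
        have := hg.2 hx; have := hx.2.2; have := hy.2 hy'; have := hm.2 hy'.1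
        simp only [mem_Icc]; constructor <;> linarith) (by
        intro w hw h1 h2
        have := hWy w hw (hm0.trans (hmS hw)) h2
        constructor <;> linarith)
    rcases min_cases (y - m) (mm S (2 * z / 3) z + mm S 0 r) with ⟨h, _⟩ | ⟨h, _⟩
    · have := le_max_left 0 (r - m - mm S 0 r - mm S (2 * z / 3) z)
      linarith
    · have := le_max_right 0 (r - m - mm S 0 r - mm S (2 * z / 3) z)
      linarith

lemma mm_le' (S : Set ℝ) (s t : ℝ) : mm S s t ≤ max 0 (t - s) := by
  rcases le_or_gt s t with h | h
  · exact (mm_le S h).trans (le_max_right _ _)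
  · rw [mm_empty S h]; exact le_max_left _ _

lemma mm_inter_le (S : Set ℝ) (u v s t : ℝ) : mm (S ∩ Icc u v) s t ≤ mm S s t :=
  measureReal_mono (fun _ hx => ⟨hx.1.1, hx.2⟩) (mm_ne_top _ _ _)

lemma mm_pos_ne (S : Set ℝ) (s t : ℝ) (h : 0 < mm S s t) : (S ∩ Icc s t).Nonempty := by
  by_contra hc
  rw [not_nonempty_iff_eq_empty] at hc
  simp [mm, hc] at h

lemma least_inter {S : Set ℝ} {m : ℝ} (hm : IsLeast S m) (hm0 : 0 ≤ m) {t : ℝ}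
    (hne : (S ∩ Icc 0 t).Nonempty) : IsLeast (S ∩ Icc 0 t) m := by
  obtain ⟨x, hx⟩ := hne
  exact ⟨⟨hm.1, hm0, (hm.2 hx.1).trans hx.2.2⟩, fun y hy => hm.2 hy.1⟩

lemma ex_top {S : Set ℝ} (hS : SF S) {z : ℝ} (hz : IsGreatest S z) (h0 : 0 ≤ z) :
    ∃ g0, IsLeast (S ∩ Icc (2 * z / 3) z) g0 :=
  (hS.sub _ _).1.exists_isLeast ⟨z, hz.1, by linarith, le_rfl⟩

lemma stage3 (Q : Set ℝ) (hQ : SF Q) (m v : ℝ) (hm : IsLeast Q m) (hv : IsGreatest Q v)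
    (hm6 : 6.05 ≤ m) (hv12 : v ≤ 12.01) (hq : 3.99 ≤ volume.real Q) :
    ∃ γ h : ℝ, 0 ≤ γ ∧ 0 ≤ h ∧ mm Q (2 * v / 3) v = v / 3 - γ - h ∧
      volume.real Q ≤ v / 3 - γ - 2 / 3 * h := by
  have hm0 : 0 ≤ m := by linarith
  have hmv : m ≤ v := hm.2 hv.1
  have hsub : Q ⊆ Icc 0 v := fun x hx => ⟨by linarith [hm.2 hx], hv.2 hx⟩
  have hsplit := mm_add Q hQ.meas 0 (2 * v / 3) v (by linarith) (by linarith)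
  rw [mm_full Q 0 v hsub] at hsplit
  obtain ⟨g1, hg⟩ := ex_top hQ hv (by linarith)
  have ht1 := tower1 Q hQ m v hm0 hm hv
  rw [min_eq_left (by linarith)] at ht1
  have hgl : 2 * v / 3 ≤ g1 := hg.1.2.1
  have hgv : g1 ≤ v := hg.1.2.2
  have htop : mm Q (2 * v / 3) v ≤ v - g1 := by
    have : mm Q (2 * v / 3) v = mm Q g1 v := by
      simp only [mm]; rw [top_eq Q v g1 hg]
    rw [this]; exact mm_le Q hgv
  have ht2 := tower2 Q hQ v g1 hv hg (by linarith)
  have hz : mm Q 0 (2 * g1 / 3) = 0 := by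
    have : Q ∩ Icc 0 (2 * g1 / 3) = ∅ := by
      ext x
      simp only [mem_inter_iff, mem_Icc, mem_empty_iff_false, iff_false]
      rintro ⟨hx, _, hx2⟩
      have := hm.2 hx
      linarith
    simp [mm, this]
  have hs := mm_sub Q 0 (2 * g1 / 3) (2 * v / 3)
  refine ⟨g1 - 2 * v / 3, v - g1 - mm Q (2 * v / 3) v, by linarith, by linarith, by ring, ?_⟩
  linarith

lemma stage2 (E : Set ℝ) (hE : SF E) (m z γ η : ℝ) (hη : 0 < η) (hη1 : η ≤ 1 / 1000)
    (hm0 : 0 ≤ m) (hm : IsLeast E m) (hz : IsGreatest E z)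
    (hγ : 0 ≤ γ) (hγ4 : γ ≤ 5) (hmz : 3 * z - 118 - γ ≤ m) (he : 18 + γ - η ≤ volume.real E)
    (hz1 : 41.36 + γ ≤ z) (hz2 : z ≤ 50 + η) (hzm : volume.real E ≤ z - m) :
    ∃ γG hG v γQ hQ : ℝ, 0 ≤ γG ∧ 0 ≤ hG ∧ 0 ≤ γQ ∧ 0 ≤ hQ ∧
      mm E (2 * z / 3) z = z / 3 - γG - hG ∧
      v / 3 - γQ - hQ ≤ mm E (2 * v / 3) v ∧
      13 / 9 * z ≤ 236 / 3 + 2 * γ / 3 - volume.real E - 2 * γG / 3 - hG / 3 ∧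
      volume.real E ≤ z / 3 + v / 3 - γQ - 2 * hQ / 3 - γG - hG / 3 ∧
      volume.real E ≤ z - 2 * v - hG / 3 := by
  have hmz' : m ≤ z := hm.2 hz.1
  have hsub : E ⊆ Icc 0 z := fun x hx => ⟨by linarith [hm.2 hx], hz.2 hx⟩
  have hsplit := mm_add E hE.meas 0 (2 * z / 3) z (by linarith) (by linarith)
  rw [mm_full E 0 z hsub] at hsplit
  obtain ⟨g0, hg⟩ := ex_top hE hz (by linarith)
  have ht1 := tower1 E hE m z hm0 hm hz
  rw [min_eq_left (by linarith)] at ht1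
  have hgl : 2 * z / 3 ≤ g0 := hg.1.2.1
  have hgv : g0 ≤ z := hg.1.2.2
  have htop : mm E (2 * z / 3) z ≤ z - g0 := by
    have : mm E (2 * z / 3) z = mm E g0 z := by
      simp only [mm]; rw [top_eq E z g0 hg]
    rw [this]; exact mm_le E hgv
  have ht2 := tower2 E hE z g0 hz hg (by linarith)
  have hs := mm_sub E 0 (2 * g0 / 3) (2 * z / 3)
  have hdpos : 0 < mm E 0 (2 * g0 / 3) := by linarith
  have ht3 := tower3 E hE m z g0 (2 * g0 / 3) hm0 hm hz hg (by linarith) (mm_pos_ne _ _ _ hdpos)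
    (by linarith)
  rw [max_eq_left (by linarith)] at ht3
  set θ := (g0 + m) / 3 with hθ
  have hs2 := mm_sub E 0 θ (2 * g0 / 3)
  set q := mm E 0 θ with hq
  have hqpos : 0 < q := by linarith
  have hne := mm_pos_ne _ _ _ hqpos
  have hQ := hE.sub 0 θ
  have hQm := least_inter hm hm0 hne
  obtain ⟨v, hv⟩ := hQ.1.exists_isGreatest hne
  have hvθ : v ≤ θ := hv.1.2.2
  have hmv : m ≤ v := hv.2 hQm.1
  have hqv : q ≤ v - m := by
    have : mm (E ∩ Icc 0 θ) m v = q := mm_full _ _ _ (fun x hx => ⟨hQm.2 hx, hv.2 hx⟩)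
    rw [← this]; exact mm_le _ hmv
  have eq : volume.real (E ∩ Icc 0 θ) = q := rfl
  obtain ⟨γQ, h, h1, h2, h3, h4⟩ := stage3 _ hQ m v hQm hv (by linarith) (by linarith)
    (by linarith)
  have h5 := mm_inter_le E 0 θ (2 * v / 3) v
  refine ⟨g0 - 2 * z / 3, z - g0 - mm E (2 * z / 3) z, v, γQ, h, by linarith, by linarith, h1, h2,
    by ring, by linarith, by linarith, by linarith, by linarith⟩

lemma stage1 (K : Set ℝ) (hK : SF K) (a η : ℝ) (hη : 0 < η) (hη1 : η ≤ 1 / 1000)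
    (hsub : K ⊆ Icc 0 177) (h177 : 177 ∈ K) (ha : a = volume.real K) (ha1 : 77 - η ≤ a)
    (hlam : ∀ T, 0 ≤ T → T ≤ 177 → mm K 0 T ≤ (a + η) / 177 * T) :
    ∃ γ h m θ z : ℝ, 0 ≤ γ ∧ 0 ≤ h ∧ 0 ≤ m ∧ γ ≤ 5 ∧ mm K 118 177 = 59 - γ - h ∧
      IsLeast (K ∩ Icc 0 θ) m ∧ IsGreatest (K ∩ Icc 0 θ) z ∧ 3 * z - 118 - γ ≤ m ∧
      a - 59 + γ + h / 3 ≤ volume.real (K ∩ Icc 0 θ) ∧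
      41.36 + γ ≤ z ∧ z ≤ 50 + η ∧ volume.real (K ∩ Icc 0 θ) ≤ z - m := by
  have hlam' : ∀ T0 T, 0 ≤ T → T ≤ T0 → T ≤ 177 →
      mm K 0 T ≤ 77 / 177 * T + (a - 77 + η) * T0 / 177 := by
    intro T0 T h0 h1 h2
    refine (hlam T h0 h2).trans ?_
    have : 0 ≤ (a - 77 + η) * (T0 - T) := mul_nonneg (by linarith) (by linarith)
    nlinarith
  obtain ⟨m, hm⟩ := hK.1.exists_isLeast ⟨177, h177⟩
  have hm0 : 0 ≤ m := (hsub hm.1).1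
  have hz : IsGreatest K 177 := ⟨h177, fun x hx => (hsub hx).2⟩
  obtain ⟨g0, hg⟩ := ex_top hK hz (by norm_num)
  have hgl := hg.1.2.1
  have hgv := hg.1.2.2
  have ht1 := tower1 K hK m 177 hm0 hm hz
  have htop : mm K (2 * 177 / 3) 177 ≤ 177 - g0 := by
    have : mm K (2 * 177 / 3) 177 = mm K g0 177 := by
      simp only [mm]; rw [top_eq K 177 g0 hg]
    rw [this]; exact mm_le K hgv
  have ht2 := tower2 K hK 177 g0 hz hg
  have ht3 := fun r => tower3 K hK m 177 g0 r hm0 hm hz hg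
  rw [show (2 * 177 / 3 : ℝ) = 118 by norm_num] at *
  have hsplit := mm_add K hK.meas 0 118 177 (by norm_num) (by norm_num)
  rw [mm_full K 0 177 hsub, ← ha] at hsplit
  rw [← ha] at ht1
  have hb : mm K 0 118 ≤ 41 + η := by
    rcases min_cases (177 - m) (2 * a) with ⟨h, _⟩ | ⟨h, _⟩ <;> rw [h] at ht1 <;> linarith
  have ht2 := ht2 (by linarith)
  set c := mm K 118 177 with hc
  obtain ⟨r, left, hr1, hr2, hl0, hl⟩ : ∃ r left : ℝ, r ≤ 177 / 2 ∧ r = 2 * g0 / 3 - left ∧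
      0 ≤ left ∧ (left = 0 ∨ left = 2 * g0 / 3 - 177 / 2) := by
    rcases le_total (2 * g0 / 3) (177 / 2) with h | h
    · exact ⟨_, 0, h, by ring, le_rfl, Or.inl rfl⟩
    · exact ⟨177 / 2, 2 * g0 / 3 - 177 / 2, le_rfl, by ring, by linarith, Or.inr rfl⟩
  have hl' : left ≤ 2 / 3 * (g0 - 118) := by rcases hl with h | h <;> linarith
  have hs1 := mm_sub K 0 r 118
  have hs2 := mm_sub K r (2 * g0 / 3) 118
  have hs3 : mm K r (2 * g0 / 3) ≤ left := (mm_le K (by linarith)).trans (by linarith)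
  have hdpos : 0 < mm K 0 r := by linarith
  have hdne := mm_pos_ne _ _ _ hdpos
  have hmr : m ≤ r := (least_inter hm hm0 hdne).1.2.2
  have ht3 := ht3 r hr1 hdne (by linarith)
  set θ := (g0 + m) / 3 with hθ
  have hs4 := mm_sub K 0 θ r
  have hlθ := hlam' 77 θ (by linarith) (by linarith) (by linarith)
  set d := mm K 0 r with hd
  set e := mm K 0 θ with he
  have hmax : 3 * mm K θ r ≤ 177 - g0 - c := by
    rcases max_cases 0 (r - m - d - c) with ⟨h, _⟩ | ⟨h, _⟩ <;> rw [h] at ht3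
    · linarith
    · exfalso
      rcases hl with h | h <;> linarith
  have hepos : 0 < e := by linarith
  have hene := mm_pos_ne _ _ _ hepos
  have hEm := least_inter hm hm0 hene
  have hE := hK.sub 0 θ
  obtain ⟨z, hzE⟩ := hE.1.exists_isGreatest hene
  have hzθ : z ≤ θ := hzE.1.2.2
  have hmz : m ≤ z := hzE.2 hEm.1
  have hez : e ≤ z - m := by
    have : mm (K ∩ Icc 0 θ) m z = e := mm_full _ _ _ (fun x hx => ⟨hEm.2 hx, hzE.2 hx⟩)
    rw [← this]; exact mm_le _ hmz
  have hez2 : e ≤ mm K 0 z := by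
    have : mm (K ∩ Icc 0 θ) 0 z = e :=
      mm_full _ _ _ (fun x hx => ⟨hm0.trans (hEm.2 hx), hzE.2 hx⟩)
    rw [← this]; exact mm_inter_le _ _ _ _ _
  have hleft : left = 0 ∧ g0 ≤ 123 := by
    rcases hl with h | h
    · exact ⟨h, by linarith⟩
    · exfalso; linarith
  obtain ⟨hleft, hg123⟩ := hleft
  have hz50 : z ≤ 50 + η := by linarith
  have hlz := hlam' 51 z (by linarith) (by linarith) (by linarith)
  have ee : volume.real (K ∩ Icc 0 θ) = e := rfl
  exact ⟨g0 - 118, 177 - g0 - c, m, θ, z, by linarith, by linarith, hm0, by linarith, by ring, hEm,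
    hzE, by linarith, by linarith, by linarith, hz50, by linarith⟩

lemma main_lemma (K : Set ℝ) (hK : SF K) (a η : ℝ) (hη : 0 < η) (hη1 : η ≤ 1 / 1000)
    (hsub : K ⊆ Icc 0 177) (h177 : 177 ∈ K) (ha : a = volume.real K) (ha1 : 77 - η ≤ a)
    (hlam : ∀ T, 0 ≤ T → T ≤ 177 → mm K 0 T ≤ (a + η) / 177 * T) :
    a ≤ 77 ∧ 59 - 100 * η ≤ mm K 118 177 ∧ 14 - 100 * η ≤ mm K 28 42 ∧
      4 - 100 * η ≤ mm K 8 12 := by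
  obtain ⟨γ, h, m, θ, z, hγ, hh, hm0, hγ5, h1, hm, hz, h2, h3, h4, h5, h6⟩ :=
    stage1 K hK a η hη hη1 hsub h177 ha ha1 hlam
  obtain ⟨γG, hG, v, γQ, hQ, g1, g2, g3, g4, g5, g6, g7, g8, g9⟩ :=
    stage2 _ (hK.sub 0 θ) m z γ η hη hη1 hm0 hm hz hγ hγ5 h2 (by linarith) h4 h5 h6
  have i1 := mm_inter_le K 0 θ (2 * z / 3) z
  have i2 := mm_inter_le K 0 θ (2 * v / 3) v
  set e := volume.real (K ∩ Icc 0 θ) with he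
  have hz1 : z ≤ 42 + η := by linarith
  have hz2 : 42 - 3 * η ≤ z := by linarith
  have hv1 : v ≤ 12 + 2 * η := by linarith
  have hv2 : 12 - 4 * η ≤ v := by linarith
  have j1 : mm K (2 * z / 3) 28 ≤ 2 * η := (mm_le' _ _ _).trans (max_le (by linarith) (by linarith))
  have j2 : mm K 42 z ≤ η := (mm_le' _ _ _).trans (max_le (by linarith) (by linarith))
  have j3 : mm K (2 * v / 3) 8 ≤ 3 * η := (mm_le' _ _ _).trans (max_le (by linarith) (by linarith))
  have j4 : mm K 12 v ≤ 2 * η := (mm_le' _ _ _).trans (max_le (by linarith) (by linarith))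
  have k1 := mm_sub K (2 * z / 3) 28 z
  have k2 := mm_sub K 28 42 z
  have k3 := mm_sub K (2 * v / 3) 8 v
  have k4 := mm_sub K 8 12 v
  refine ⟨by linarith, by linarith, by linarith, by linarith⟩

lemma real_smul' (c : ℝ) (hc : 0 < c) (S : Set ℝ) :
    volume.real (c • S) = c * volume.real S := by
  rw [Measure.real, Measure.addHaar_smul]
  simp [Measure.real, abs_of_pos hc, ENNReal.toReal_mul, hc.le]

lemma SF.smul {S : Set ℝ} (h : SF S) (c : ℝ) (hc : 0 < c) : SF (c • S) := by
  refine ⟨h.1.smul c, ?_⟩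
  rintro _ ⟨x, hx, rfl⟩ _ ⟨y, hy, rfl⟩ _ ⟨z, hz, rfl⟩ he
  refine h.2 x hx y hy z hz ?_
  simp only [smul_eq_mul] at he
  have : c * (x + y) = c * (3 * z) := by linarith
  exact mul_left_cancel₀ hc.ne' this

lemma mm_smul (c : ℝ) (hc : 0 < c) (S : Set ℝ) (s t : ℝ) :
    mm (c • S) (c * s) (c * t) = c * mm S s t := by
  have : (c • S) ∩ Icc (c * s) (c * t) = c • (S ∩ Icc s t) := by
    ext x
    constructor
    · rintro ⟨⟨y, hy, rfl⟩, h1, h2⟩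
      exact ⟨y, ⟨hy, le_of_mul_le_mul_left h1 hc, le_of_mul_le_mul_left h2 hc⟩, rfl⟩
    · rintro ⟨y, ⟨hy, h1, h2⟩, rfl⟩
      exact ⟨⟨y, hy, rfl⟩, mul_le_mul_of_nonneg_left h1 hc.le, mul_le_mul_of_nonneg_left h2 hc.le⟩
  rw [mm, this, real_smul' c hc]; rfl

lemma rescale (M : ℝ) (hM : ∀ K, SF K → K ⊆ Icc 0 177 → volume.real K ≤ M)
    (K : Set ℝ) (hK : SF K) (hsub : K ⊆ Icc 0 177) (hpos : 0 < volume.real K) :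
    ∃ (ρ : ℝ) (K' : Set ℝ), 0 < ρ ∧ ρ ≤ 1 ∧ K = ρ • K' ∧ SF K' ∧ K' ⊆ Icc 0 177 ∧ (177 : ℝ) ∈ K' ∧
      ∀ T, 0 ≤ T → T ≤ 177 → mm K' 0 T ≤ M / 177 * T := by
  have hne : K.Nonempty := by
    by_contra hc
    rw [not_nonempty_iff_eq_empty] at hc
    simp [hc] at hpos
  obtain ⟨t, ht⟩ := hK.1.exists_isGreatest hne
  have ht0 : 0 < t := by
    by_contra hc
    have h1 : K ⊆ Icc 0 0 := fun x hx => ⟨(hsub hx).1, (ht.2 hx).trans (not_lt.1 hc)⟩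
    have h2 := mm_full K 0 0 h1
    have h3 := mm_le K (le_refl (0 : ℝ))
    linarith
  have ht177 := (hsub ht.1).2
  have hc : 0 < 177 / t := by positivity
  have hK' := hK.smul (177 / t) hc
  refine ⟨t / 177, (177 / t) • K, by positivity, by linarith, ?_, hK', ?_, ?_, ?_⟩
  · rw [smul_smul, show t / 177 * (177 / t) = 1 by field_simp, one_smul]
  · rintro _ ⟨x, hx, rfl⟩
    have h0 := (hsub hx).1
    have h1 := ht.2 hx
    simp only [smul_eq_mul]
    refine ⟨by positivity, ?_⟩
    calc 177 / t * x ≤ 177 / t * t := by gcongr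
      _ = 177 := by field_simp
  · exact ⟨t, ht.1, by simp only [smul_eq_mul]; field_simp⟩
  · intro T h0 h1
    rcases h0.eq_or_lt with rfl | h0
    · have := mm_le ((177 / t) • K) (le_refl (0 : ℝ))
      linarith
    have hc2 : 0 < 177 / T := by positivity
    have := hM _ ((hK'.sub 0 T).smul (177 / T) hc2) (by
      rintro _ ⟨x, hx, rfl⟩
      have h0 := hx.2.1
      have h1 := hx.2.2
      simp only [smul_eq_mul]
      refine ⟨by positivity, ?_⟩
      calc 177 / T * x ≤ 177 / T * T := by gcongr
        _ = 177 := by field_simp)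
    rw [real_smul' _ hc2] at this
    change 177 / T * mm ((177 / t) • K) 0 T ≤ M at this
    have h5 : mm ((177 / t) • K) 0 T = T / 177 * (177 / T * mm ((177 / t) • K) 0 T) := by
      field_simp
    rw [h5]
    calc T / 177 * (177 / T * mm ((177 / t) • K) 0 T) ≤ T / 177 * M := by gcongr
      _ = M / 177 * T := by ring

lemma bound77 (K : Set ℝ) (hK : SF K) (hsub : K ⊆ Icc 0 177) : volume.real K ≤ 77 := by
  by_contra hcon
  push Not at hcon
  set V : Set ℝ := {x | ∃ K, SF K ∧ K ⊆ Icc 0 177 ∧ volume.real K = x} with hV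
  have hbdd : BddAbove V := by
    refine ⟨177, ?_⟩
    rintro _ ⟨K, h1, h2, rfl⟩
    rw [← mm_full K 0 177 h2]
    exact (mm_le K (by norm_num)).trans (by norm_num)
  have hM : ∀ K, SF K → K ⊆ Icc 0 177 → volume.real K ≤ sSup V := fun K h1 h2 =>
    le_csSup hbdd ⟨K, h1, h2, rfl⟩
  have hM77 : 77 < sSup V := hcon.trans_le (hM K hK hsub)
  set M := sSup V
  set η := min (1 / 1000) ((M - 77) / 2) with hη
  have hη0 : 0 < η := lt_min (by norm_num) (by linarith)
  have hη1 : η ≤ 1 / 1000 := min_le_left _ _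
  have hη2 : η ≤ (M - 77) / 2 := min_le_right _ _
  obtain ⟨_, ⟨L, hL, hLs, rfl⟩, hLM⟩ := exists_lt_of_lt_csSup (s := V)
    ⟨_, K, hK, hsub, rfl⟩ (show M - η < sSup V from by linarith)
  obtain ⟨ρ, K', h1, h2, h3, h4, h5, h6, h7⟩ := rescale M hM L hL hLs (by linarith)
  have h8 : volume.real L = ρ * volume.real K' := by rw [h3, real_smul' ρ h1]
  have h9 : volume.real L ≤ volume.real K' := by
    rw [h8]; exact mul_le_of_le_one_left measureReal_nonneg h2
  have := (main_lemma K' h4 _ η hη0 hη1 h5 h6 rfl (by linarith) (by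
    intro T hT0 hT1
    refine (h7 T hT0 hT1).trans ?_
    have : M ≤ volume.real K' + η := by linarith
    gcongr)).1
  linarith

lemma approx (K : Set ℝ) (hK : SF K) (hsub : K ⊆ Icc 0 177) (η : ℝ) (hη : 0 < η)
    (hη1 : η ≤ 1 / 1000) (hv : 77 - η ≤ volume.real K) :
    59 - 105 * η ≤ mm K 118 177 ∧ 14 - 105 * η ≤ mm K 28 42 ∧ 4 - 105 * η ≤ mm K 8 12 := by
  obtain ⟨ρ, K', h1, h2, h3, h4, h5, h6, h7⟩ := rescale 77 bound77 K hK hsub (by linarith)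
  have h8 : volume.real K = ρ * volume.real K' := by rw [h3, real_smul' ρ h1]
  have h9 : volume.real K ≤ volume.real K' := by
    rw [h8]; exact mul_le_of_le_one_left measureReal_nonneg h2
  have hb := bound77 K' h4 h5
  have hρ : 1 - ρ ≤ η / 77 := by nlinarith
  obtain ⟨_, m1, m2, m3⟩ := main_lemma K' h4 _ η hη hη1 h5 h6 rfl (by linarith) (by
    intro T hT0 hT1
    refine (h7 T hT0 hT1).trans ?_
    have : 77 ≤ volume.real K' + η := by linarith
    gcongr)
  have key : ∀ p q : ℝ, 0 ≤ p → p ≤ 118 → p ≤ q → q - p ≤ 59 →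
      mm K' p q - 5 * η ≤ mm K p q := by
    intro p q hp hp2 hpq hq
    have e1 : mm K (ρ * p) (ρ * q) = ρ * mm K' p q := by rw [h3, mm_smul ρ h1]
    have e2 := mm_sub K (ρ * p) p (ρ * q)
    have e3 : mm K p (ρ * q) ≤ mm K p q := mm_mono K le_rfl (by nlinarith)
    have e4 : mm K (ρ * p) p ≤ p - ρ * p := mm_le K (by nlinarith)
    have e5 : mm K' p q ≤ q - p := mm_le K' hpq
    have e6 := mm_nonneg K' p q
    have e7 : (1 - ρ) * p ≤ η / 77 * 118 := mul_le_mul hρ hp2 hp (by positivity)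
    have e8 : (1 - ρ) * mm K' p q ≤ η / 77 * 59 :=
      mul_le_mul hρ (by linarith) e6 (by positivity)
    nlinarith
  have k1 := key 118 177 (by norm_num) (by norm_num) (by norm_num) (by norm_num)
  have k2 := key 28 42 (by norm_num) (by norm_num) (by norm_num) (by norm_num)
  have k3 := key 8 12 (by norm_num) (by norm_num) (by norm_num) (by norm_num)
  exact ⟨by linarith, by linarith, by linarith⟩

lemma full_big (B : Set ℝ) (hB : B ⊆ Icc 0 177) (hmeas : MeasurableSet B)
    (hsf : ∀ x ∈ B, ∀ y ∈ B, ∀ z ∈ B, x + y ≠ 3 * z) (hμ : volume.real B = 77) :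
    59 ≤ mm B 118 177 ∧ 14 ≤ mm B 28 42 ∧ 4 ≤ mm B 8 12 := by
  have hfin : volume B ≠ ⊤ := ((measure_mono hB).trans_lt (by simp [Real.volume_Icc])).ne
  have key : ∀ η : ℝ, 0 < η → η ≤ 1 / 1000 → 59 - 105 * η ≤ mm B 118 177 ∧
      14 - 105 * η ≤ mm B 28 42 ∧ 4 - 105 * η ≤ mm B 8 12 := by
    intro η h0 h1
    have hlt : ENNReal.ofReal (77 - η) < volume B := by
      rw [← ENNReal.ofReal_toReal hfin]
      apply (ENNReal.ofReal_lt_ofReal_iff' ).2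
      change 77 - η < volume.real B ∧ 0 < volume.real B
      rw [hμ]; constructor <;> linarith
    obtain ⟨K, hKB, hKc, hK⟩ := hmeas.exists_lt_isCompact hlt
    have hKfin : volume K ≠ ⊤ := ((measure_mono hKB).trans_lt hfin.lt_top).ne
    have hv : 77 - η ≤ volume.real K := by
      rw [Measure.real]
      exact (ENNReal.ofReal_le_iff_le_toReal hKfin).1 hK.le
    have mono : ∀ s t, mm K s t ≤ mm B s t := fun s t =>
      measureReal_mono (inter_subset_inter_left _ hKB) (mm_ne_top _ _ _)
    obtain ⟨a1, a2, a3⟩ := approx K ⟨hKc, fun x hx y hy z hz =>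
      hsf x (hKB hx) y (hKB hy) z (hKB hz)⟩ (hKB.trans hB) η h0 h1 hv
    exact ⟨a1.trans (mono _ _), a2.trans (mono _ _), a3.trans (mono _ _)⟩
  have lim : ∀ x y : ℝ, (∀ η : ℝ, 0 < η → η ≤ 1 / 1000 → x - 105 * η ≤ y) → x ≤ y := by
    intro x y h
    by_contra hc
    push Not at hc
    have h1 : min (1 / 1000) ((x - y) / 210) ≤ (x - y) / 210 := min_le_right _ _
    have := h (min (1 / 1000) ((x - y) / 210)) (lt_min (by norm_num) (by linarith))
      (min_le_left _ _)
    linarith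
  exact ⟨lim _ _ fun η h0 h1 => (key η h0 h1).1, lim _ _ fun η h0 h1 => (key η h0 h1).2.1,
    lim _ _ fun η h0 h1 => (key η h0 h1).2.2⟩

lemma null_diff (A : Set ℝ) (hmeas : MeasurableSet A) (p q : ℝ) (hpq : p ≤ q)
    (h : q - p ≤ mm A p q) : volume (Ioo p q \ A) = 0 := by
  have h1 : volume.real (Icc p q ∩ A) + volume.real (Icc p q \ A) = volume.real (Icc p q) :=
    measureReal_inter_add_sdiff hmeas (by simp [Real.volume_Icc])
  rw [Real.volume_real_Icc_of_le hpq, inter_comm] at h1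
  have h2 : volume.real (Icc p q \ A) = 0 := by
    have : 0 ≤ volume.real (Icc p q \ A) := measureReal_nonneg
    unfold mm at h
    linarith
  have hfin : volume (Icc p q \ A) ≠ ⊤ :=
    ((measure_mono sdiff_subset).trans_lt (by simp [Real.volume_Icc])).ne
  rw [measureReal_eq_zero_iff hfin] at h2
  exact measure_mono_null (sdiff_subset_sdiff_left Ioo_subset_Icc_self) h2
open MeasureTheory Set

/-- **Structure lemma.** If `A` is a measurable 3-sum-free subset of `[0,1]` with
`μ(A) = 77/177`, then the symmetric difference of `A` with
`𝒜₀ = (8/177, 4/59) ∪ (28/177, 14/59) ∪ (2/3, 1)` has measure zero. -/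
theorem symmDiff_measure_zero (A : Set ℝ)
    (hA : A ⊆ Icc (0 : ℝ) 1) (hmeas : MeasurableSet A)
    (hsf : ∀ x ∈ A, ∀ y ∈ A, ∀ z ∈ A, x + y ≠ 3 * z)
    (hμ : volume A = 77 / 177) :
    volume (symmDiff A
      (Ioo (8/177 : ℝ) (4/59) ∪ Ioo (28/177 : ℝ) (14/59) ∪ Ioo (2/3 : ℝ) 1)) = 0 := by
  have hreal : volume.real A = 77 / 177 := by
    rw [Measure.real, hμ, ENNReal.toReal_div]; norm_num
  have h177 : (0 : ℝ) < 177 := by norm_num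
  obtain ⟨b1, b2, b3⟩ := full_big ((177 : ℝ) • A) (by
      rintro _ ⟨x, hx, rfl⟩
      have := hA hx
      simp only [smul_eq_mul, mem_Icc] at *
      constructor <;> linarith) (hmeas.const_smul_of_ne_zero h177.ne') (by
      rintro _ ⟨x, hx, rfl⟩ _ ⟨y, hy, rfl⟩ _ ⟨z, hz, rfl⟩ he
      refine hsf x hx y hy z hz ?_
      simp only [smul_eq_mul] at he
      linarith) (by rw [real_smul' _ h177, hreal]; norm_num)
  have c1 := mm_smul 177 h177 A (2 / 3) 1
  have c2 := mm_smul 177 h177 A (28 / 177) (14 / 59)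
  have c3 := mm_smul 177 h177 A (8 / 177) (4 / 59)
  norm_num at c1 c2 c3
  have d1 := null_diff A hmeas (2 / 3) 1 (by norm_num) (by linarith)
  have d2 := null_diff A hmeas (28 / 177) (14 / 59) (by norm_num) (by linarith)
  have d3 := null_diff A hmeas (8 / 177) (4 / 59) (by norm_num) (by linarith)
  set I : Set ℝ := Ioo (8/177 : ℝ) (4/59) ∪ Ioo (28/177 : ℝ) (14/59) ∪ Ioo (2/3 : ℝ) 1 with hI
  have hIA : volume (I \ A) = 0 := by
    rw [hI, union_sdiff_distrib, union_sdiff_distrib]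
    exact measure_union_null (measure_union_null d3 d2) d1
  have hIm : MeasurableSet I := (measurableSet_Ioo.union measurableSet_Ioo).union measurableSet_Ioo
  have hIv : volume.real I = 77 / 177 := by
    have e1 : volume.real (Ioo (8/177 : ℝ) (4/59) ∪ Ioo (28/177 : ℝ) (14/59))
        = 4 / 177 + 14 / 177 := by
      rw [measureReal_union _ measurableSet_Ioo (by simp) (by simp),
        Real.volume_real_Ioo_of_le (by norm_num), Real.volume_real_Ioo_of_le (by norm_num)]
      · norm_num
      · rw [Set.disjoint_left]
        rintro x ⟨_, h1⟩ ⟨h2, _⟩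
        linarith
    rw [hI, measureReal_union _ measurableSet_Ioo
      (measure_union_ne_top (by simp) (by simp)) (by simp), e1,
      Real.volume_real_Ioo_of_le (by norm_num)]
    · norm_num
    · rw [Set.disjoint_left]
      rintro x (⟨_, h1⟩ | ⟨_, h1⟩) ⟨h2, _⟩ <;> linarith
  have hAfin : volume A ≠ ⊤ := ((measure_mono hA).trans_lt (by simp [Real.volume_Icc])).ne
  have hIfin : volume I ≠ ⊤ := by
    intro h
    simp [Measure.real, h] at hIv
    norm_num at hIv
  have f1 : volume.real (A ∩ I) + volume.real (A \ I) = volume.real A :=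
    measureReal_inter_add_sdiff hIm hAfin
  have f2 : volume.real (I ∩ A) + volume.real (I \ A) = volume.real I :=
    measureReal_inter_add_sdiff hmeas hIfin
  have f3 : volume.real (I \ A) = 0 := by simp [Measure.real, hIA]
  rw [inter_comm] at f2
  have f4 : volume.real (A \ I) = 0 := by linarith
  have hAI : volume (A \ I) = 0 :=
    (measureReal_eq_zero_iff ((measure_mono sdiff_subset).trans_lt hAfin.lt_top).ne).1 f4
  rw [Set.symmDiff_def]
  exact measure_union_null hAI hIA
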